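/- arXiv:2403.16966 — 2 statements merged into one kernel-verified Lean document; each statement's English description precedes it below -/
import Mathlib

section
/- Let n, c be positive integers, ρ > 0, C > 0, λ₃ ∈ ℝ^{n×c}, and fix Y, F⁰ ∈ ℝ^{n×c}. Define A := (ρY + λ₃ + C·F⁰)/(ρ + C). Then the function φ(F) := ⟨λ₃, Y − F⟩ + (ρ/2)‖Y − F‖_F² + (C/2)‖F − F⁰‖_F² has a unique minimizer F* over the box { F ∈ ℝ^{n×c} : 0 ≤ F_{st} ≤ 1 for all s,t }, given entrywise by F*_{st} = min{1, max{0, A_{st}}}. -/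
open Matrix BigOperators

/-- Squared Frobenius norm ‖A‖_F² = Tr(AᵀA). -/
noncomputable def frobSq {m k : Type*} [Fintype m] [Fintype k] (A : Matrix m k ℝ) : ℝ :=
  ∑ i, ∑ j, (A i j) ^ 2

/-- Trace inner product ⟨A,B⟩ = Tr(AᵀB). -/
noncomputable def finner {m k : Type*} [Fintype m] [Fintype k] (A B : Matrix m k ℝ) : ℝ :=
  ∑ i, ∑ j, (A i j) * (B i j)

/-- Variational inequality for the projection of `a` onto `[0, 1]`. -/
lemma clip_sub_mul_nonneg (a x : ℝ) (h0 : 0 ≤ x) (h1 : x ≤ 1) :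
    0 ≤ (min 1 (max 0 a) - a) * (x - min 1 (max 0 a)) := by
  rcases le_total a 0 with ha | ha
  · rw [max_eq_left ha, min_eq_right zero_le_one]
    nlinarith
  · rw [max_eq_right ha]
    rcases le_total a 1 with hb | hb
    · simp [min_eq_right hb]
    · rw [min_eq_left hb]
      nlinarith

/-- Quadratic growth of the scalar objective around the clipped point. -/
lemma scalar_objective_growth {ρ C l y z a x : ℝ} (hs : 0 < ρ + C)
    (ha : (ρ + C) * a = ρ * y + l + C * z) (h0 : 0 ≤ x) (h1 : x ≤ 1) :
    l * (y - min 1 (max 0 a)) + ρ / 2 * (y - min 1 (max 0 a)) ^ 2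
        + C / 2 * (min 1 (max 0 a) - z) ^ 2 + (ρ + C) / 2 * (x - min 1 (max 0 a)) ^ 2
      ≤ l * (y - x) + ρ / 2 * (y - x) ^ 2 + C / 2 * (x - z) ^ 2 := by
  have h := mul_nonneg hs.le (clip_sub_mul_nonneg a x h0 h1)
  generalize min 1 (max 0 a) = p at *
  linear_combination h - (x - p) * ha

lemma eq_of_frobSq_sub_nonpos {m k : Type*} [Fintype m] [Fintype k] {A B : Matrix m k ℝ}
    (h : frobSq (A - B) ≤ 0) : A = B := by
  ext i j
  have hle : ((A - B) i j) ^ 2 ≤ frobSq (A - B) :=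
    (Finset.single_le_sum (f := fun j => ((A - B) i j) ^ 2)
      (fun _ _ => sq_nonneg _) (Finset.mem_univ j)).trans
    (Finset.single_le_sum (f := fun i => ∑ j, ((A - B) i j) ^ 2)
      (fun _ _ => Finset.sum_nonneg fun _ _ => sq_nonneg _) (Finset.mem_univ i))
  have hz : (A - B) i j = 0 := pow_eq_zero_iff two_ne_zero |>.mp
    (le_antisymm (hle.trans h) (sq_nonneg _))
  exact sub_eq_zero.mp hz

lemma frobSq_nonneg {m k : Type*} [Fintype m] [Fintype k] (A : Matrix m k ℝ) :
    0 ≤ frobSq A :=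
  Finset.sum_nonneg fun _ _ => Finset.sum_nonneg fun _ _ => sq_nonneg _

/-- Closed-form solution of the F-subproblem (e) of the PAM method: entrywise
projection onto [0,1]. -/
theorem stmt_8 (n c : ℕ) (hn : 0 < n) (hc : 0 < c)
    (ρ C : ℝ) (hρ : 0 < ρ) (hC : 0 < C)
    (lam3 Y F0 : Matrix (Fin n) (Fin c) ℝ)
    (A : Matrix (Fin n) (Fin c) ℝ)
    (hA : A = ((ρ + C)⁻¹ : ℝ) • (ρ • Y + lam3 + C • F0))
    (φ : Matrix (Fin n) (Fin c) ℝ → ℝ)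
    (hφ : ∀ F, φ F = finner lam3 (Y - F) + (ρ / 2) * frobSq (Y - F)
      + (C / 2) * frobSq (F - F0))
    (Fstar : Matrix (Fin n) (Fin c) ℝ)
    (hFstar : ∀ s t, Fstar s t = min 1 (max 0 (A s t))) :
    (∀ s t, 0 ≤ Fstar s t ∧ Fstar s t ≤ 1) ∧
    (∀ F : Matrix (Fin n) (Fin c) ℝ, (∀ s t, 0 ≤ F s t ∧ F s t ≤ 1) → φ Fstar ≤ φ F) ∧
    (∀ F : Matrix (Fin n) (Fin c) ℝ, (∀ s t, 0 ≤ F s t ∧ F s t ≤ 1) →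
      (∀ F' : Matrix (Fin n) (Fin c) ℝ, (∀ s t, 0 ≤ F' s t ∧ F' s t ≤ 1) → φ F ≤ φ F') →
      F = Fstar) := by
  have hs : 0 < ρ + C := add_pos hρ hC
  have hbox : ∀ s t, 0 ≤ Fstar s t ∧ Fstar s t ≤ 1 := fun s t => by
    rw [hFstar]
    exact ⟨le_min zero_le_one (le_max_left _ _), min_le_left _ _⟩
  have growth : ∀ F : Matrix (Fin n) (Fin c) ℝ, (∀ s t, 0 ≤ F s t ∧ F s t ≤ 1) →
      φ Fstar + (ρ + C) / 2 * frobSq (F - Fstar) ≤ φ F := by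
    intro F hF
    simp only [hφ, finner, frobSq, Finset.mul_sum, ← Finset.sum_add_distrib]
    refine Finset.sum_le_sum fun s _ => Finset.sum_le_sum fun t _ => ?_
    have ha : (ρ + C) * A s t = ρ * Y s t + lam3 s t + C * F0 s t := by
      rw [hA, Matrix.smul_apply, smul_eq_mul, mul_inv_cancel_left₀ hs.ne']
      simp
    simpa only [Matrix.sub_apply, hFstar] using
      scalar_objective_growth hs ha (hF s t).1 (hF s t).2
  refine ⟨hbox, fun F hF => ?_, fun F hF hmin => ?_⟩
  · have := mul_nonneg (half_pos hs).le (frobSq_nonneg (F - Fstar))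
    linarith [growth F hF]
  · refine eq_of_frobSq_sub_nonpos (nonpos_of_mul_nonpos_right ?_ (half_pos hs))
    linarith [growth F hF, hmin Fstar hbox]
end

section
/- Let n ≥ c be positive integers, ρ > 0, C > 0, λ₄ ∈ ℝ^{n×c}, and fix Y, Ŷ⁰ ∈ ℝ^{n×c}. Define B := (ρY − λ₄ + C·Ŷ⁰)/(ρ + C), and suppose B = UΣVᵀ where U ∈ ℝ^{n×n} and V ∈ ℝ^{c×c} are orthogonal matrices and Σ ∈ ℝ^{n×c} satisfies Σ_{ij} = 0 for i ≠ j and Σ_{ii} ≥ 0 for all i ≤ c. Then Ŷ* := U·I_{n×c}·Vᵀ (where I_{n×c} ∈ ℝ^{n×c} has (I_{n×c})_{ii} = 1 for i ≤ c and other entries 0) is a minimizer of the function φ(Ŷ) := ⟨λ₄, Ŷ − Y⟩ + (ρ/2)‖Ŷ − Y‖_F² + (C/2)‖Ŷ − Ŷ⁰‖_F² over the set { Ŷ ∈ ℝ^{n×c} : ŶᵀŶ = I_c }. -/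
open Matrix BigOperators

section FrobeniusInnerProduct

variable {m k : Type*} [Fintype m] [Fintype k]

lemma finner_eq_trace (A B : Matrix m k ℝ) : finner A B = trace (Aᵀ * B) := by
  simp only [finner, trace, diag_apply, mul_apply, transpose_apply]
  exact Finset.sum_comm

lemma frobSq_eq_finner (A : Matrix m k ℝ) : frobSq A = finner A A := by
  simp only [frobSq, finner, sq]

lemma frobSq_eq_card [DecidableEq k] {A : Matrix m k ℝ} (hA : Aᵀ * A = 1) :
    frobSq A = Fintype.card k := by
  rw [frobSq_eq_finner, finner_eq_trace, hA, trace_one]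

lemma frobSq_sub (A B : Matrix m k ℝ) :
    frobSq (A - B) = frobSq A - 2 * finner B A + frobSq B := by
  simp only [frobSq, finner, Finset.mul_sum, ← Finset.sum_sub_distrib, ← Finset.sum_add_distrib,
    Matrix.sub_apply]
  exact Finset.sum_congr rfl fun i _ => Finset.sum_congr rfl fun j _ => by ring

lemma finner_sub_right (A B D : Matrix m k ℝ) :
    finner A (B - D) = finner A B - finner A D := by
  simp only [finner_eq_trace, Matrix.mul_sub, trace_sub]

lemma finner_mul_mul_transpose (U : Matrix m m ℝ) (S X : Matrix m k ℝ) (V : Matrix k k ℝ) :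
    finner (U * S * Vᵀ) X = finner S (Uᵀ * X * V) := by
  simp only [finner_eq_trace, transpose_mul, transpose_transpose, Matrix.mul_assoc]
  rw [trace_mul_comm]
  simp only [Matrix.mul_assoc]

/-- On the Stiefel manifold, the proximal augmented Lagrangian term is an affine function of
the inner product with `ρ • Y - L + C • Y₀`. -/
lemma proximal_objective_eq [DecidableEq k] (ρ C : ℝ) (L Y Y₀ : Matrix m k ℝ)
    {X : Matrix m k ℝ} (hX : Xᵀ * X = 1) :
    finner L (X - Y) + (ρ / 2) * frobSq (X - Y) + (C / 2) * frobSq (X - Y₀) =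
      (ρ + C) / 2 * Fintype.card k - finner L Y + ρ / 2 * frobSq Y + C / 2 * frobSq Y₀
        - finner (ρ • Y - L + C • Y₀) X := by
  have h : finner (ρ • Y - L + C • Y₀) X = ρ * finner Y X - finner L X + C * finner Y₀ X := by
    simp only [finner_eq_trace, transpose_add, transpose_sub, transpose_smul, Matrix.add_mul,
      Matrix.sub_mul, smul_mul, trace_add, trace_sub, trace_smul, smul_eq_mul]
  rw [h, frobSq_sub, frobSq_sub, finner_sub_right, frobSq_eq_card hX]
  ring

lemma transpose_mul_self_conj_eq_one [DecidableEq m] [DecidableEq k] {U : Matrix m m ℝ}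
    {V : Matrix k k ℝ} {X : Matrix m k ℝ} (hU : Uᵀ * U = 1) (hV : V * Vᵀ = 1)
    (hX : Xᵀ * X = 1) : (U * X * Vᵀ)ᵀ * (U * X * Vᵀ) = 1 := by
  calc (U * X * Vᵀ)ᵀ * (U * X * Vᵀ) = V * (Xᵀ * (Uᵀ * U) * X) * Vᵀ := by
        simp only [transpose_mul, transpose_transpose, Matrix.mul_assoc]
    _ = 1 := by rw [hU, Matrix.mul_one, hX, Matrix.mul_one, hV]

end FrobeniusInnerProduct

lemma apply_le_one_of_transpose_mul_self {m k : Type*} [Fintype m] [DecidableEq k]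
    {Z : Matrix m k ℝ} (hZ : Zᵀ * Z = 1) (i : m) (j : k) : Z i j ≤ 1 := by
  have h : ∑ l, Z l j * Z l j = 1 := by
    simpa [mul_apply] using congrFun (congrFun hZ j) j
  have h' : Z i j * Z i j ≤ ∑ l, Z l j * Z l j :=
    Finset.single_le_sum (f := fun l => Z l j * Z l j) (fun l _ => mul_self_nonneg _)
      (Finset.mem_univ i)
  nlinarith

section RectangularDiagonal

variable {n c : ℕ}

lemma rectangular_one_transpose_mul_self (hcn : c ≤ n) :
    (Matrix.of fun (i : Fin n) (j : Fin c) => if (i : ℕ) = (j : ℕ) then (1 : ℝ) else 0)ᵀ *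
      (Matrix.of fun (i : Fin n) (j : Fin c) => if (i : ℕ) = (j : ℕ) then (1 : ℝ) else 0) = 1 := by
  ext j j'
  simp only [mul_apply, transpose_apply, of_apply]
  rw [Finset.sum_eq_single (Fin.castLE hcn j)]
  · simp [one_apply, Fin.ext_iff]
  · intro i _ hi
    have : (i : ℕ) ≠ j := fun h => hi (Fin.ext h)
    simp [this]
  · simp

/-- A nonnegative rectangular diagonal matrix has maximal inner product with the rectangular
identity among all matrices with orthonormal columns. -/
lemma finner_le_finner_rectangular_one (hcn : c ≤ n) {S Z : Matrix (Fin n) (Fin c) ℝ}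
    (hoff : ∀ (i : Fin n) (j : Fin c), (i : ℕ) ≠ (j : ℕ) → S i j = 0)
    (hdiag : ∀ i : Fin c, 0 ≤ S (Fin.castLE hcn i) i) (hZ : Zᵀ * Z = 1) :
    finner S Z ≤ finner S (Matrix.of fun (i : Fin n) (j : Fin c) =>
      if (i : ℕ) = (j : ℕ) then (1 : ℝ) else 0) := by
  refine Finset.sum_le_sum fun i _ => Finset.sum_le_sum fun j _ => ?_
  by_cases h : (i : ℕ) = j
  · obtain rfl : i = Fin.castLE hcn j := Fin.ext h
    simpa using mul_le_mul_of_nonneg_left (apply_le_one_of_transpose_mul_self hZ _ j) (hdiag j)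
  · simp [hoff i j h]

end RectangularDiagonal

/-- Closed-form solution of the Ŷ-subproblem (f) of the PAM method via SVD. -/
theorem stmt_10 (n c : ℕ) (hc : 0 < c) (hcn : c ≤ n)
    (ρ C : ℝ) (hρ : 0 < ρ) (hC : 0 < C)
    (lam4 Y Yh0 : Matrix (Fin n) (Fin c) ℝ)
    (B : Matrix (Fin n) (Fin c) ℝ)
    (hB : B = ((ρ + C)⁻¹ : ℝ) • (ρ • Y - lam4 + C • Yh0))
    (U : Matrix (Fin n) (Fin n) ℝ) (V : Matrix (Fin c) (Fin c) ℝ)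
    (hU : Uᵀ * U = 1) (hV : Vᵀ * V = 1)
    (Sig : Matrix (Fin n) (Fin c) ℝ)
    (hSigOff : ∀ (i : Fin n) (j : Fin c), (i : ℕ) ≠ (j : ℕ) → Sig i j = 0)
    (hSigDiag : ∀ i : Fin c, 0 ≤ Sig (Fin.castLE hcn i) i)
    (hSVD : B = U * Sig * Vᵀ)
    (φ : Matrix (Fin n) (Fin c) ℝ → ℝ)
    (hφ : ∀ Yh, φ Yh = finner lam4 (Yh - Y) + (ρ / 2) * frobSq (Yh - Y)
      + (C / 2) * frobSq (Yh - Yh0))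
    (Yhstar : Matrix (Fin n) (Fin c) ℝ)
    (hYhstar : Yhstar = U * (Matrix.of fun (i : Fin n) (j : Fin c) =>
      if (i : ℕ) = (j : ℕ) then (1 : ℝ) else 0) * Vᵀ) :
    Yhstarᵀ * Yhstar = 1 ∧
    ∀ Yh : Matrix (Fin n) (Fin c) ℝ, Yhᵀ * Yh = 1 → φ Yhstar ≤ φ Yh := by
  have hV' : V * Vᵀ = 1 := mul_eq_one_comm.mp hV
  have hU' : U * Uᵀ = 1 := mul_eq_one_comm.mp hU
  have hstar : Yhstarᵀ * Yhstar = 1 := by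
    rw [hYhstar]
    exact transpose_mul_self_conj_eq_one hU hV' (rectangular_one_transpose_mul_self hcn)
  refine ⟨hstar, fun X hX => ?_⟩
  have hpos : 0 < ρ + C := add_pos hρ hC
  have hlin : ρ • Y - lam4 + C • Yh0 = U * ((ρ + C) • Sig) * Vᵀ := by
    rw [Matrix.mul_smul, smul_mul, ← hSVD, hB, smul_smul, mul_inv_cancel₀ hpos.ne', one_smul]
  have hZ : (Uᵀ * X * V)ᵀ * (Uᵀ * X * V) = 1 := by
    simpa using transpose_mul_self_conj_eq_one (U := Uᵀ) (V := Vᵀ) (by simpa using hU')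
      (by simpa using hV) hX
  have hUV : Uᵀ * Yhstar * V = Matrix.of fun (i : Fin n) (j : Fin c) =>
      if (i : ℕ) = (j : ℕ) then (1 : ℝ) else 0 := by
    rw [hYhstar, Matrix.mul_assoc, Matrix.mul_assoc, hV, Matrix.mul_one, ← Matrix.mul_assoc, hU,
      Matrix.one_mul]
  rw [hφ, hφ, proximal_objective_eq ρ C lam4 Y Yh0 hstar, proximal_objective_eq ρ C lam4 Y Yh0 hX,
    hlin, finner_mul_mul_transpose, finner_mul_mul_transpose, hUV]
  refine sub_le_sub_left (finner_le_finner_rectangular_one hcn (fun i j h => ?_) (fun i => ?_) hZ) _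
  · simp [hSigOff i j h]
  · exact mul_nonneg hpos.le (hSigDiag i)
end
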